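/- arXiv:2505.17203 — 2 statements merged into one kernel-verified Lean document; each statement's English description precedes it below -/
import Mathlib

section
/- Let n, d, s be positive integers, let X be a real n × d matrix, let v ∈ ℝ^d, let S be a set of coordinate indices with |S| ≤ s, and let ℓ, C, λ > 0 be reals. Suppose (i) the cone-type inequality (2ℓ/n)·‖Xv‖₂² + λ‖v_{Sᶜ}‖₁ ≤ 3λ‖v_S‖₁ holds, and (ii) the restricted-eigenvalue condition (C/2)·‖v‖₂² ≤ (1/n)·‖Xv‖₂² holds. Then ‖v‖₂² ≤ 16·s·λ² / (ℓ²·C²). -/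
open Finset

/-- Let `n, d, s` be positive integers, `X` a real `n × d` matrix, `v ∈ ℝ^d`,
`S` a set of coordinate indices with `|S| ≤ s`, and `ℓ, C, λ > 0`. If
(i) `(2ℓ/n)‖Xv‖₂² + λ‖v_{Sᶜ}‖₁ ≤ 3λ‖v_S‖₁` and
(ii) `(C/2)‖v‖₂² ≤ (1/n)‖Xv‖₂²`,
then `‖v‖₂² ≤ 16 s λ² / (ℓ² C²)`. -/
theorem stmt_9 (n d s : ℕ) (hn : 0 < n) (hd : 0 < d) (hs : 0 < s)
    (X : Matrix (Fin n) (Fin d) ℝ) (v : Fin d → ℝ) (S : Finset (Fin d)) (hS : S.card ≤ s)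
    (ℓ C lam : ℝ) (hℓ : 0 < ℓ) (hC : 0 < C) (hlam : 0 < lam)
    (hcone : (2 * ℓ / n) * (∑ j, (X.mulVec v j) ^ 2) + lam * ∑ i ∈ Sᶜ, |v i| ≤
      3 * lam * ∑ i ∈ S, |v i|)
    (hRE : (C / 2) * (∑ i, (v i) ^ 2) ≤ (1 / n) * ∑ j, (X.mulVec v j) ^ 2) :
    (∑ i, (v i) ^ 2) ≤ 16 * s * lam ^ 2 / (ℓ ^ 2 * C ^ 2) := by
  have hN : 0 ≤ ∑ i, v i ^ 2 := sum_nonneg fun i _ => sq_nonneg _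
  have hA : (∑ i ∈ S, |v i|) ^ 2 ≤ s * ∑ i, v i ^ 2 := by
    calc (∑ i ∈ S, |v i|) ^ 2 ≤ S.card * ∑ i ∈ S, |v i| ^ 2 := sq_sum_le_card_mul_sum_sq
      _ = S.card * ∑ i ∈ S, v i ^ 2 := by simp only [sq_abs]
      _ ≤ s * ∑ i, v i ^ 2 := by
        gcongr
        exact subset_univ S
  have hcompl : 0 ≤ lam * ∑ i ∈ Sᶜ, |v i| :=
    mul_nonneg hlam.le (sum_nonneg fun i _ => abs_nonneg _)
  have hlin : ℓ * C * ∑ i, v i ^ 2 ≤ 3 * lam * ∑ i ∈ S, |v i| := by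
    calc ℓ * C * ∑ i, v i ^ 2 = 2 * ℓ * (C / 2 * ∑ i, v i ^ 2) := by ring
      _ ≤ 2 * ℓ * (1 / n * ∑ j, X.mulVec v j ^ 2) := by gcongr
      _ = 2 * ℓ / n * ∑ j, X.mulVec v j ^ 2 := by ring
      _ ≤ 3 * lam * ∑ i ∈ S, |v i| := by linarith
  generalize ∑ i, v i ^ 2 = N at *
  generalize ∑ i ∈ S, |v i| = A at *
  rcases hN.eq_or_lt with rfl | hpos
  · positivity
  rw [le_div_iff₀ (by positivity)]
  refine le_of_mul_le_mul_right ?_ hpos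
  calc N * (ℓ ^ 2 * C ^ 2) * N = (ℓ * C * N) ^ 2 := by ring
    _ ≤ (3 * lam * A) ^ 2 := by gcongr
    _ = 9 * lam ^ 2 * A ^ 2 := by ring
    _ ≤ 16 * lam ^ 2 * (s * N) := by gcongr; norm_num
    _ = 16 * s * lam ^ 2 * N := by ring
end

section
/- Let F : ℝ → ℝ be twice differentiable with |F′(v)| ≤ B and |F″(v)| ≤ B′ for all v ∈ ℝ, fix u ∈ ℝ and P ≥ 0, and define rev(p) := p·(1 − F(p − u)). Suppose p* ∈ [0, P] satisfies rev′(p*) = 0. Then for every p ∈ [0, P], rev(p*) − rev(p) ≤ ((2B + P·B′)/2)·(p − p*)². -/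
/-- A function on a convex set whose second derivative is at least `-C` drops by at most
`C / 2 * (x - a) ^ 2` from its value at a critical point `a`. -/
theorem sub_le_of_critical_of_neg_le_second_deriv {s : Set ℝ} (hs : Convex ℝ s)
    {f f' f'' : ℝ → ℝ} {C a x : ℝ} (hf : ∀ y ∈ s, HasDerivAt f (f' y) y)
    (hf' : ∀ y ∈ s, HasDerivAt f' (f'' y) y) (hC : ∀ y ∈ s, -C ≤ f'' y)
    (ha : a ∈ s) (hx : x ∈ s) (hfa : f' a = 0) :
    f a - f x ≤ C / 2 * (x - a) ^ 2 := by
  have hg : ∀ y ∈ s, HasDerivAt (fun y => f y + C / 2 * (y - a) ^ 2) (f' y + C * (y - a)) y := by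
    intro y hy
    refine ((hf y hy).add ((((hasDerivAt_id' y).sub_const a).pow 2).const_mul (C / 2))).congr_deriv ?_
    push_cast
    ring
  have hg' : ∀ y ∈ s, HasDerivAt (fun y => f' y + C * (y - a)) (f'' y + C) y := by
    intro y hy
    exact ((hf' y hy).add (((hasDerivAt_id' y).sub_const a).const_mul C)).congr_deriv (by ring)
  have hconv : ConvexOn ℝ s (fun y => f y + C / 2 * (y - a) ^ 2) :=
    convexOn_of_hasDerivWithinAt2_nonneg hs (fun y hy => (hg y hy).continuousAt.continuousWithinAt)
      (fun y hy => (hg y (interior_subset hy)).hasDerivWithinAt)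
      (fun y hy => (hg' y (interior_subset hy)).hasDerivWithinAt)
      (fun y hy => by linarith [hC y (interior_subset hy)])
  have hga : HasDerivAt (fun y => f y + C / 2 * (y - a) ^ 2) 0 a := by
    simpa [hfa] using hg a ha
  rcases lt_trichotomy a x with h | rfl | h
  · have hslope := hconv.le_slope_of_hasDerivAt ha hx h hga
    rw [slope_def_field, le_div_iff₀ (sub_pos.2 h)] at hslope
    nlinarith
  · simp
  · have hslope := hconv.slope_le_of_hasDerivAt hx ha h hga
    rw [slope_def_field, div_le_iff₀ (sub_pos.2 h)] at hslope
    nlinarith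

/-- Let `F : ℝ → ℝ` be twice differentiable (first derivative `F'`, second
derivative `F''`) with `|F'| ≤ B` and `|F''| ≤ B'` everywhere, fix `u ∈ ℝ` and `P ≥ 0`, and
define `rev p := p * (1 - F (p - u))`. Suppose `p* ∈ [0, P]` satisfies `rev' p* = 0`. Then for
every `p ∈ [0, P]`, `rev p* - rev p ≤ ((2B + P B') / 2) * (p - p*) ^ 2`. -/
theorem stmt_17 (F F' F'' : ℝ → ℝ)
    (hF : ∀ v, HasDerivAt F (F' v) v) (hF' : ∀ v, HasDerivAt F' (F'' v) v)
    (B B' : ℝ) (hB : ∀ v, |F' v| ≤ B) (hB' : ∀ v, |F'' v| ≤ B')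
    (u P : ℝ) (hP : 0 ≤ P)
    (pstar : ℝ) (hpstar : pstar ∈ Set.Icc (0 : ℝ) P)
    (hcrit : deriv (fun q : ℝ => q * (1 - F (q - u))) pstar = 0) :
    ∀ p ∈ Set.Icc (0 : ℝ) P,
      pstar * (1 - F (pstar - u)) - p * (1 - F (p - u)) ≤
        ((2 * B + P * B') / 2) * (p - pstar) ^ 2 := by
  intro p hp
  have hshift : ∀ q, HasDerivAt (fun q => F (q - u)) (F' (q - u)) q := fun q =>
    (hF (q - u)).comp_sub_const q u
  have hshift' : ∀ q, HasDerivAt (fun q => F' (q - u)) (F'' (q - u)) q := fun q =>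
    (hF' (q - u)).comp_sub_const q u
  have hrev : ∀ q, HasDerivAt (fun q => q * (1 - F (q - u)))
      (1 - F (q - u) - q * F' (q - u)) q := fun q =>
    ((hasDerivAt_id' q).mul ((hshift q).const_sub 1)).congr_deriv (by ring)
  have hrev' : ∀ q, HasDerivAt (fun q => 1 - F (q - u) - q * F' (q - u))
      (-2 * F' (q - u) - q * F'' (q - u)) q := fun q =>
    (((hshift q).const_sub 1).sub ((hasDerivAt_id' q).mul (hshift' q))).congr_deriv (by ring)
  refine sub_le_of_critical_of_neg_le_second_deriv (convex_Icc 0 P) (fun q _ => hrev q)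
    (fun q _ => hrev' q) ?_ hpstar hp ((hrev pstar).deriv.symm.trans hcrit)
  rintro q ⟨hq0, hqP⟩
  have hB'0 : 0 ≤ B' := (abs_nonneg _).trans (hB' 0)
  have hF'q := (abs_le.1 (hB (q - u))).2
  have hF''q : q * F'' (q - u) ≤ P * B' :=
    (mul_le_mul_of_nonneg_left (abs_le.1 (hB' (q - u))).2 hq0).trans
      (mul_le_mul_of_nonneg_right hqP hB'0)
  linarith
end
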